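/- Let x be a rooted tree with |x| = k+1, and let w = w₁w₂⋯w_r be a valid x-word in the letters 𝔑 and 𝔓: for each 1 ≤ i ≤ r the number of 𝔓's in w_i w_{i+1}⋯w_r does not exceed the number of 𝔑's there, and the total number of 𝔑's minus the total number of 𝔓's in w equals k. Let S = {i : w_i = 𝔓}, and for each i ∈ S let a_i = #{j : j ≥ i, w_j = 𝔓}, b_i = #{j : j > i, w_j = 𝔑}, and c_i = b_i − a_i. Then (w(•), x) = m(•;x) · Π_{i∈S} C(c_i+2, 2), where w(•) denotes the composite operator w₁∘w₂∘⋯∘w_r applied to • and C(n,2) is the binomial coefficient. -/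

import Mathlib

attribute [local instance] Classical.propDecidable

inductive PlanarTree : Type where
  | node : List PlanarTree → PlanarTree

namespace PlanarTree

/-- Isomorphism of (planar representatives of) rooted trees: the lists of
principal branches match up, pairwise isomorphically, after a permutation. -/
inductive Iso : PlanarTree → PlanarTree → Prop where
  | node {l m l' : List PlanarTree} :
      List.Perm l m → List.Forall₂ Iso m l' → Iso (node l) (node l')

/-- Number of vertices. -/
def size : PlanarTree → ℕ
  | node l => 1 + (l.attach.map fun c => size c.1).sum
decreasing_by simp only [PlanarTree.node.sizeOf_spec]; exact Nat.lt_of_lt_of_le (List.sizeOf_lt_of_mem c.2) (Nat.le_add_left _ _)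

mutual
  /-- All trees obtained by attaching the root of `s` by a new edge to some vertex. -/
  def graftList (s : PlanarTree) : PlanarTree → List PlanarTree
    | node l => node (s :: l) :: (graftAux s l).map node
  def graftAux (s : PlanarTree) : List PlanarTree → List (List PlanarTree)
    | [] => []
    | a :: l => ((graftList s a).map (· :: l)) ++ (graftAux s l).map (a :: ·)
end

/-- All trees obtained by adding a new edge and terminal vertex at some vertex. -/
def growList (t : PlanarTree) : List PlanarTree := graftList (node []) t

mutual
  /-- All trees obtained by deleting one (non-root) terminal vertex. -/
  def pruneList : PlanarTree → List PlanarTree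
    | node l => (pruneAux l).map node
  def pruneAux : List PlanarTree → List (List PlanarTree)
    | [] => []
    | a :: l =>
        (match a with | node [] => [l] | _ => []) ++
        ((pruneList a).map (· :: l)) ++ (pruneAux l).map (a :: ·)
end

mutual
  /-- All pairs (cut-off subtree, remaining tree) obtained by cutting one edge. -/
  def cutPairs : PlanarTree → List (PlanarTree × PlanarTree)
    | node l => (cutAux l).map fun x => (x.1, node x.2)
  def cutAux : List PlanarTree → List (PlanarTree × List PlanarTree)
    | [] => []
    | a :: l =>
        (a, l) :: (((cutPairs a).map fun x => (x.1, x.2 :: l)) ++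
          (cutAux l).map fun x => (x.1, a :: x.2))
end

/-- The order of the symmetry group `SG(t)`: the product over all vertices `v`
of the number of permutations of the branches at `v` exchanging isomorphic branches. -/
noncomputable def sg : PlanarTree → ℕ
  | node l =>
      (l.attach.map fun c => sg c.1).prod *
        Nat.card {σ : Equiv.Perm (Fin l.length) // ∀ i, Iso (l.get (σ i)) (l.get i)}
decreasing_by simp only [PlanarTree.node.sizeOf_spec]; exact Nat.lt_of_lt_of_le (List.sizeOf_lt_of_mem c.2) (Nat.le_add_left _ _)

/-- Vertices of a planar tree, encoded as paths of child-indices from the root. -/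
inductive IsVertex : PlanarTree → List ℕ → Prop where
  | root (t : PlanarTree) : IsVertex t []
  | child {l : List PlanarTree} {i : ℕ} {c : PlanarTree} {p : List ℕ} :
      l[i]? = some c → IsVertex c p → IsVertex (node l) (i :: p)

def Vertex (t : PlanarTree) : Type := {p : List ℕ // IsVertex t p}

/-- `v` lies strictly below `w` in the tree order (i.e. `w` is a proper ancestor of `v`). -/
def StrictBelow {t : PlanarTree} (v w : Vertex t) : Prop := w.1 <+: v.1 ∧ w.1 ≠ v.1

/-- A labelling of `t`. -/
def Labelling (t : PlanarTree) : Type :=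
  {f : Vertex t ≃ Fin t.size // ∀ v w, StrictBelow v w → f w < f v}

/-- Equivalence of labellings: they differ by an automorphism of the rooted tree. -/
def labelEquiv {t : PlanarTree} (f g : Labelling t) : Prop :=
  ∃ φ : Equiv.Perm (Vertex t),
    (∀ v w, StrictBelow (φ v) (φ w) ↔ StrictBelow v w) ∧ ∀ v, f.1 (φ v) = g.1 v

end PlanarTree

/-- Rooted trees: isomorphism classes of planar rooted trees. -/
instance planarSetoid : Setoid PlanarTree := Relation.EqvGen.setoid PlanarTree.Iso

def RTree : Type := Quotient planarSetoid

namespace RTree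

def mk (p : PlanarTree) : RTree := ⟦p⟧

/-- A chosen planar representative. -/
noncomputable def rep (T : RTree) : PlanarTree := Quotient.out T

noncomputable def size (T : RTree) : ℕ := T.rep.size

/-- The order of the symmetry (automorphism) group of `T`. -/
noncomputable def sg (T : RTree) : ℕ := T.rep.sg

/-- The one-vertex tree. -/
def bullet : RTree := mk (PlanarTree.node [])

/-- `Covers T T'` means `T ⊲ T'`: `T` is obtained from `T'` by deleting one terminal vertex. -/
noncomputable def Covers (T T' : RTree) : Prop :=
  ∃ p ∈ T'.rep.pruneList, mk p = T

/-- `n(T;T')`: the number of vertices of `T` to which a new edge can be added to obtain `T'`. -/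
noncomputable def nCov (T T' : RTree) : ℕ :=
  T.rep.growList.countP fun p => decide (mk p = T')

/-- `m(T;T')`: the number of (terminal) edges of `T'` which when removed leave `T`. -/
noncomputable def mCov (T T' : RTree) : ℕ :=
  T'.rep.pruneList.countP fun p => decide (mk p = T)

/-- `n(T₁,T₂;T₃)`: the number of vertices of `T₂` such that attaching the root of `T₁`
there by a new edge yields `T₃`. -/
noncomputable def nTri (T₁ T₂ T₃ : RTree) : ℕ :=
  (PlanarTree.graftList T₁.rep T₂.rep).countP fun p => decide (mk p = T₃)

/-- `m(T₁,T₂;T₃)`: the number of edges of `T₃` whose removal cuts off a subtree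
isomorphic to `T₁` leaving `T₂` (the piece containing the root). -/
noncomputable def mTri (T₁ T₂ T₃ : RTree) : ℕ :=
  T₃.rep.cutPairs.countP fun x => decide (mk x.1 = T₁ ∧ mk x.2 = T₂)

end RTree

section Ops

variable (k : Type*) [Semiring k]

/-- The element `𝔑(T) = Σ_{T ⊲ T'} n(T;T')·T'` of `k{T}`. -/
noncomputable def growF (T : RTree) : RTree →₀ k :=
  (T.rep.growList.map fun p => Finsupp.single (RTree.mk p) (1 : k)).sum

/-- The element `𝔓(T) = Σ_{T' ⊲ T} m(T';T)·T'` of `k{T}`. -/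
noncomputable def pruneF (T : RTree) : RTree →₀ k :=
  (T.rep.pruneList.map fun p => Finsupp.single (RTree.mk p) (1 : k)).sum

/-- The growth operator `𝔑` on `k{T}`. -/
noncomputable def Grow : Module.End k (RTree →₀ k) :=
  Finsupp.linearCombination k (growF k)

/-- The pruning operator `𝔓` on `k{T}`. -/
noncomputable def Prune : Module.End k (RTree →₀ k) :=
  Finsupp.linearCombination k (pruneF k)

/-- The operator `𝔇` on `k{T}`, `𝔇(t) = |t|·t`. -/
noncomputable def Diag : Module.End k (RTree →₀ k) :=
  Finsupp.linearCombination k fun T => (T.size : k) • Finsupp.single T 1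

/-- The inner product on `k{T}` determined by `(t,t') = |SG(t)|·δ_{t,t'}`. -/
noncomputable def innerT (x y : RTree →₀ k) : k :=
  x.sum fun T c => c * y T * (T.sg : k)

/-- Generalized multiplicity `n(T;T')`: coefficient of `T'` in `𝔑^{|T'|-|T|}(T)`. -/
noncomputable def nGen (T T' : RTree) : k :=
  ((Grow k ^ (T'.size - T.size)) (Finsupp.single T 1)) T'

/-- Generalized multiplicity `m(T;T')`: coefficient of `T` in `𝔓^{|T'|-|T|}(T')`. -/
noncomputable def mGen (T T' : RTree) : k :=
  ((Prune k ^ (T'.size - T.size)) (Finsupp.single T' 1)) T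

end Ops

section Kreimer

variable (k : Type*) [CommSemiring k]

/-- Kreimer's Hopf algebra `H_K`, as a commutative algebra: the free polynomial
algebra on rooted trees. -/
abbrev HK := MvPolynomial RTree k

/-- The inclusion `k{T} → H_K` of the linear span of the variables. -/
noncomputable def toHK : (RTree →₀ k) →ₗ[k] HK k :=
  Finsupp.linearCombination k fun T => MvPolynomial.X T

/-- The growth derivation `N` on `H_K`, with `N(t) = 𝔑(t)` for rooted trees `t`. -/
noncomputable def ND : Derivation k (HK k) (HK k) :=
  MvPolynomial.mkDerivation k fun T => toHK k (growF k T)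

/-- The pruning derivation `P` on `H_K`, with `P(t) = 𝔓(t)` for `|t| ≥ 2`, `P(•) = 1`. -/
noncomputable def PD : Derivation k (HK k) (HK k) :=
  MvPolynomial.mkDerivation k fun T =>
    if T = RTree.bullet then 1 else toHK k (pruneF k T)

/-- The grading derivation `D` on `H_K`, multiplying each homogeneous element of
degree `n` by `n`; it is the derivation with `D(t) = |t|·t` for rooted trees `t`. -/
noncomputable def DD : Derivation k (HK k) (HK k) :=
  MvPolynomial.mkDerivation k fun T => (T.size : k) • MvPolynomial.X T

/-- The map `B₊ : H_K → k{T}` sending a forest to the tree obtained by attaching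
all its roots to a new root vertex. -/
noncomputable def forestTree (d : RTree →₀ ℕ) : RTree :=
  RTree.mk (PlanarTree.node
    (d.support.toList.flatMap fun T => List.replicate (d T) T.rep))

noncomputable def Bplus (p : HK k) : RTree →₀ k :=
  ∑ d ∈ p.support, Finsupp.single (forestTree d) (MvPolynomial.coeff d p)

/-- The inner product on `H_K`. -/
noncomputable def innerHK (u v : HK k) : k := innerT k (Bplus k u) (Bplus k v)

/-- The degree-`n` homogeneous component of `H_K`. -/
noncomputable abbrev HKcomp (n : ℕ) : Submodule k (HK k) :=
  MvPolynomial.weightedHomogeneousSubmodule k (fun T : RTree => T.size) n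

/-- `T_i`: the number of rooted trees with `i+1` vertices. -/
noncomputable def Tcard (i : ℕ) : ℕ := Nat.card {T : RTree // T.size = i + 1}

end Kreimer

/-- Letters for words in the growth and pruning operators. -/
inductive Letter : Type where
  | gN : Letter  -- the letter `𝔑`
  | gP : Letter  -- the letter `𝔓`
deriving DecidableEq

/-- The operator corresponding to a letter. -/
noncomputable def letterOp (k : Type*) [Semiring k] : Letter → Module.End k (RTree →₀ k)
  | Letter.gN => Grow k
  | Letter.gP => Prune k

namespace PlanarTree

theorem induction_on_branches {p : PlanarTree → Prop}
    (h : ∀ l : List PlanarTree, (∀ a ∈ l, p a) → p (node l)) : ∀ t, p t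
  | node l => h l fun a _ => induction_on_branches h a

theorem size_node (l : List PlanarTree) : size (node l) = 1 + (l.map size).sum := by
  rw [size, List.attach_map_val]

theorem eq_leaf_of_size_eq_one {p : PlanarTree} (h : p.size = 1) : p = node [] := by
  rcases p with ⟨_ | ⟨⟨m⟩, l⟩⟩
  · rfl
  · simp [size_node] at h

section Sums

variable {M : Type*} [AddCommMonoid M]

theorem sum_map_sum_comm {α β : Type*} (l : List α) (m : List β) (f : α → β → M) :
    (l.map fun a => (m.map fun b => f a b).sum).sum =
      (m.map fun b => (l.map fun a => f a b).sum).sum := by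
  induction l with
  | nil => simp
  | cons a l ih => simp [ih, List.sum_map_add]

theorem sum_graftAux_cons (s a : PlanarTree) (l : List PlanarTree)
    (f : List PlanarTree → M) :
    ((graftAux s (a :: l)).map f).sum =
      ((graftList s a).map fun b => f (b :: l)).sum +
        ((graftAux s l).map fun m => f (a :: m)).sum := by
  simp [graftAux, Function.comp_def]

theorem sum_growList_node (l : List PlanarTree) (f : PlanarTree → M) :
    ((growList (node l)).map f).sum =
      f (node (node [] :: l)) + ((graftAux (node []) l).map fun m => f (node m)).sum := by
  simp [growList, graftList, Function.comp_def]

theorem sum_pruneAux_cons (a : PlanarTree) (l : List PlanarTree) (f : List PlanarTree → M) :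
    ((pruneAux (a :: l)).map f).sum =
      (if a = node [] then f l else 0) + ((pruneList a).map fun b => f (b :: l)).sum +
        ((pruneAux l).map fun m => f (a :: m)).sum := by
  rcases a with ⟨_ | ⟨b, m⟩⟩ <;> simp [pruneAux, Function.comp_def, add_assoc]

theorem sum_pruneList_node (l : List PlanarTree) (f : PlanarTree → M) :
    ((pruneList (node l)).map f).sum = ((pruneAux l).map fun m => f (node m)).sum := by
  simp [pruneList, Function.comp_def]

theorem ne_leaf_of_mem_growList {t p : PlanarTree} (h : p ∈ growList t) : p ≠ node [] := by
  cases t with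
  | node l =>
    have hne : ∀ l : List PlanarTree, [] ∉ graftAux (node []) l := by
      intro l
      cases l <;> simp [graftAux]
    rintro rfl
    simp [growList, graftList, hne] at h

theorem sum_pruneAux_graftAux (l : List PlanarTree)
    (h : ∀ a ∈ l, ∀ f : PlanarTree → M,
      ((growList a).map fun p => ((pruneList p).map f).sum).sum =
        ((pruneList a).map fun q => ((growList q).map f).sum).sum + a.size • f a)
    (f : List PlanarTree → M) :
    ((graftAux (node []) l).map fun m => ((pruneAux m).map f).sum).sum =
      ((pruneAux l).map fun m => ((graftAux (node []) m).map f).sum).sum +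
        (l.map size).sum • f l := by
  induction l generalizing f with
  | nil => simp [graftAux, pruneAux]
  | cons a l ih =>
    have h1 : ((growList a).map fun p => if p = node [] then f l else 0).sum = 0 := by
      refine List.sum_eq_zero fun x hx => ?_
      obtain ⟨p, hp, rfl⟩ := List.mem_map.1 hx
      exact if_neg (ne_leaf_of_mem_growList hp)
    have h2 := h a (by simp) fun b => f (b :: l)
    have h3 := ih (fun b hb => h b (by simp [hb])) fun m => f (a :: m)
    have h4 : ((graftAux (node []) l).map fun m => if a = node [] then f m else 0).sum =
        if a = node [] then ((graftAux (node []) l).map f).sum else 0 := by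
      split_ifs <;> simp
    simp only [growList] at h1 h2
    simp only [sum_graftAux_cons, sum_pruneAux_cons, List.sum_map_add, h1, h2, h3, h4,
      List.map_cons, List.sum_cons, add_smul]
    rw [sum_map_sum_comm (graftList _ a), sum_map_sum_comm (graftAux _ l)]
    abel

/-- The commutation relation `𝔓𝔑 - 𝔑𝔓 = 𝔇` on planar trees. -/
theorem sum_pruneList_growList (t : PlanarTree) (f : PlanarTree → M) :
    ((growList t).map fun p => ((pruneList p).map f).sum).sum =
      ((pruneList t).map fun q => ((growList q).map f).sum).sum + t.size • f t := by
  induction t using induction_on_branches generalizing f with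
  | h l ih =>
    simp only [sum_growList_node, sum_pruneList_node, sum_pruneAux_cons, if_true,
      List.sum_map_add, sum_pruneAux_graftAux l ih, size_node, add_smul, one_smul]
    simp only [pruneAux, List.map_nil, List.sum_nil]
    abel

theorem size_of_mem_growList {t p : PlanarTree} (h : p ∈ growList t) :
    p.size = t.size + 1 := by
  induction t using induction_on_branches generalizing p with
  | h l ih =>
    have aux : ∀ m ∈ graftAux (node []) l, (m.map size).sum = (l.map size).sum + 1 := by
      clear h
      induction l with
      | nil => simp [graftAux]
      | cons a l ihl =>
        intro m hm
        simp only [graftAux, List.mem_append, List.mem_map] at hm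
        obtain ⟨b, hb, rfl⟩ | ⟨m, hm, rfl⟩ := hm
        · simp [ih a (by simp) hb, add_right_comm]
        · simp [ihl (fun b hb => ih b (by simp [hb])) m hm, add_assoc]
    simp only [growList, graftList, List.mem_cons, List.mem_map] at h
    obtain rfl | ⟨m, hm, rfl⟩ := h
    · simp [size_node]; omega
    · simp [size_node, aux m hm]; omega

end Sums

section Picks

/-- All ways to single out one entry of a list, together with the remaining list. -/
def picks {α : Type*} : List α → List (α × List α)
  | [] => []
  | a :: l => (a, l) :: (picks l).map fun x => (x.1, a :: x.2)

variable {α M : Type*} [AddCommMonoid M]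

theorem sum_picks_cons (a : α) (l : List α) (f : α → List α → M) :
    ((picks (a :: l)).map fun x => f x.1 x.2).sum =
      f a l + ((picks l).map fun x => f x.1 (a :: x.2)).sum := by
  simp [picks, Function.comp_def]

theorem perm_of_mem_picks {l : List α} {x : α × List α} (h : x ∈ picks l) :
    (x.1 :: x.2).Perm l := by
  induction l generalizing x with
  | nil => simp [picks] at h
  | cons a l ih =>
    simp only [picks, List.mem_cons, List.mem_map] at h
    obtain rfl | ⟨y, hy, rfl⟩ := h
    · rfl
    · exact (List.Perm.swap _ _ _).trans ((ih hy).cons a)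

theorem sum_picks_picks_comm (l : List α) (f : α → α → List α → M) :
    ((picks l).map fun x => ((picks x.2).map fun y => f x.1 y.1 y.2).sum).sum =
      ((picks l).map fun x => ((picks x.2).map fun y => f y.1 x.1 y.2).sum).sum := by
  induction l generalizing f with
  | nil => simp [picks]
  | cons a l ih =>
    rw [sum_picks_cons a l fun b r => ((picks r).map fun y => f b y.1 y.2).sum,
      sum_picks_cons a l fun b r => ((picks r).map fun y => f y.1 b y.2).sum]
    have h1 : ∀ (b : α) (r : List α), ((picks (a :: r)).map fun y => f b y.1 y.2).sum =
      f b a r + ((picks r).map fun y => f b y.1 (a :: y.2)).sum := fun b r => sum_picks_cons a r _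
    have h2 : ∀ (b : α) (r : List α), ((picks (a :: r)).map fun y => f y.1 b y.2).sum =
      f a b r + ((picks r).map fun y => f y.1 b (a :: y.2)).sum :=
        fun b r => sum_picks_cons a r fun c s => f c b s
    simp only [h1, h2, List.sum_map_add, ih fun b c r => f b c (a :: r)]
    abel

theorem sum_picks_perm {l l' : List α} (h : l.Perm l') (f : α → List α → M)
    (hf : ∀ a r r', r.Perm r' → f a r = f a r') :
    ((picks l).map fun x => f x.1 x.2).sum = ((picks l').map fun x => f x.1 x.2).sum := by
  induction h generalizing f with
  | nil => rfl
  | cons a h ih =>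
    rw [sum_picks_cons, sum_picks_cons, hf a _ _ h,
      ih (fun b r => f b (a :: r)) fun b r r' hr => hf b _ _ (hr.cons a)]
  | swap a b l =>
    rw [sum_picks_cons, sum_picks_cons, sum_picks_cons a l fun c r => f c (b :: r),
      sum_picks_cons b l fun c r => f c (a :: r),
      List.map_congr_left fun x _ => hf x.1 _ _ (List.Perm.swap a b x.2)]
    abel
  | trans _ _ ih1 ih2 => rw [ih1 f hf, ih2 f hf]

theorem sum_picks_pruneAux (l : List PlanarTree) (f : PlanarTree → List PlanarTree → M) :
    ((pruneAux l).map fun m => ((picks m).map fun x => f x.1 x.2).sum).sum =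
      ((picks l).map fun x => ((pruneList x.1).map fun b => f b x.2).sum +
        ((pruneAux x.2).map fun r => f x.1 r).sum).sum := by
  induction l generalizing f with
  | nil => simp [picks, pruneAux]
  | cons a l ih =>
    rw [sum_picks_cons a l fun b r => ((pruneList b).map fun b => f b r).sum +
        ((pruneAux r).map fun r => f b r).sum]
    have h1 : ((picks l).map fun x => if a = node [] then f x.1 x.2 else 0).sum =
        if a = node [] then ((picks l).map fun x => f x.1 x.2).sum else 0 := by
      split_ifs <;> simp
    have h2 := ih fun b r => f b (a :: r)
    simp only [sum_pruneAux_cons, sum_picks_cons, List.sum_map_add, h1, h2]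
    rw [sum_map_sum_comm (pruneList a)]
    abel

end Picks

mutual
  /-- The symmetric pairing of planar trees for which the pairing of two trees is the
  permanent of the matrix of pairings of their branches. -/
  def pairing : PlanarTree → PlanarTree → ℕ
    | node l, node m => forestPairing l m
  /-- The permanent of the matrix of pairings of the entries of two lists of trees. -/
  def forestPairing : List PlanarTree → List PlanarTree → ℕ
    | [], [] => 1
    | [], _ :: _ => 0
    | a :: l, l' => ((picks l').map fun x => pairing a x.1 * forestPairing l x.2).sum
end

theorem forestPairing_cons_swap (a b : PlanarTree) (l l' : List PlanarTree) :
    forestPairing (a :: b :: l) l' = forestPairing (b :: a :: l) l' := by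
  simp only [forestPairing, ← List.sum_map_mul_left]
  rw [sum_picks_picks_comm l' fun c d r => pairing a c * (pairing b d * forestPairing l r)]
  simp only [mul_left_comm]

theorem forestPairing_perm_left {l m : List PlanarTree} (h : l.Perm m) (l' : List PlanarTree) :
    forestPairing l l' = forestPairing m l' := by
  induction h generalizing l' with
  | nil => rfl
  | cons a h ih => simp only [forestPairing, ih]
  | swap a b l => exact forestPairing_cons_swap b a l l'
  | trans _ _ ih1 ih2 => rw [ih1, ih2]

theorem forestPairing_perm_right (l : List PlanarTree) {l' m' : List PlanarTree}
    (h : l'.Perm m') : forestPairing l l' = forestPairing l m' := by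
  induction l generalizing l' m' with
  | nil =>
    cases l' with
    | nil => rw [List.nil_perm.1 h]
    | cons a l' =>
      cases m' with
      | nil => simp at h
      | cons b m' => simp [forestPairing]
  | cons a l ih =>
    simp only [forestPairing]
    exact sum_picks_perm h (fun b r => pairing a b * forestPairing l r)
      fun b r r' hr => by rw [ih hr]

theorem forestPairing_pruneAux (l : List PlanarTree)
    (h : ∀ a ∈ l, ∀ b, ((growList a).map fun p => pairing p b).sum =
      ((pruneList b).map fun q => pairing a q).sum) (l' : List PlanarTree) :
    forestPairing (node [] :: l) l' +
        ((graftAux (node []) l).map fun m => forestPairing m l').sum =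
      ((pruneAux l').map fun m => forestPairing l m).sum := by
  induction l generalizing l' with
  | nil =>
    rcases l' with _ | ⟨b, _ | ⟨c, r⟩⟩
    · simp [forestPairing, graftAux, pruneAux, picks]
    · rcases b with ⟨_ | ⟨b, m⟩⟩ <;>
        simp [forestPairing, pairing, graftAux, pruneAux, picks, Function.comp_def, pruneList]
    · simp [forestPairing, graftAux, sum_pruneAux_cons, picks, Function.comp_def]
  | cons a l ih =>
    rw [forestPairing_cons_swap, sum_graftAux_cons]
    simp only [forestPairing]
    rw [sum_picks_pruneAux l' fun b r => pairing a b * forestPairing l r,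
      sum_map_sum_comm (graftList _ a), sum_map_sum_comm (graftAux _ l)]
    simp only [List.sum_map_mul_right, List.sum_map_mul_left]
    have h1 := h a (by simp)
    simp only [growList] at h1
    simp only [h1, ← ih fun b hb => h b (by simp [hb]), mul_add, List.sum_map_add,
      forestPairing]
    abel

/-- Growth and pruning are adjoint for the pairing. -/
theorem sum_growList_pairing (t u : PlanarTree) :
    ((growList t).map fun p => pairing p u).sum =
      ((pruneList u).map fun q => pairing t q).sum := by
  induction t using induction_on_branches generalizing u with
  | h l ih =>
    rcases u with ⟨l'⟩
    rw [sum_growList_node, sum_pruneList_node]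
    simp only [pairing]
    exact forestPairing_pruneAux l ih l'

theorem exists_mem_ne_zero_of_sum_ne_zero {α : Type*} {l : List α} {f : α → ℕ}
    (h : (l.map f).sum ≠ 0) : ∃ x ∈ l, f x ≠ 0 := by
  by_contra! hc
  refine h (List.sum_eq_zero fun y hy => ?_)
  obtain ⟨x, hx, rfl⟩ := List.mem_map.1 hy
  exact hc x hx

theorem pairing_self_ne_zero (t : PlanarTree) : pairing t t ≠ 0 := by
  induction t using induction_on_branches with
  | h l ih =>
    rw [pairing]
    induction l with
    | nil => simp [forestPairing]
    | cons a l ihl =>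
      have h1 := ih a (by simp)
      have h2 := ihl fun b hb => ih b (by simp [hb])
      simp [forestPairing, picks, h1, h2]

theorem size_eq_of_pairing_ne_zero {s t : PlanarTree} (h : pairing s t ≠ 0) :
    s.size = t.size := by
  induction s using induction_on_branches generalizing t with
  | h l ih =>
    rcases t with ⟨l'⟩
    rw [pairing] at h
    rw [size_node, size_node]
    congr 1
    induction l generalizing l' with
    | nil => cases l' <;> simp_all [forestPairing]
    | cons a l ihl =>
      rw [forestPairing] at h
      obtain ⟨x, hx, h⟩ := exists_mem_ne_zero_of_sum_ne_zero h
      have h1 := ih a (by simp) (left_ne_zero_of_mul h)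
      have h2 := ihl (fun b hb => ih b (by simp [hb])) x.2 (right_ne_zero_of_mul h)
      rw [← ((perm_of_mem_picks hx).map size).sum_eq]
      simp [h1, h2]

theorem iso_of_pairing_ne_zero {s t : PlanarTree} (h : pairing s t ≠ 0) : Iso s t := by
  induction s using induction_on_branches generalizing t with
  | h l ih =>
    rcases t with ⟨l'⟩
    rw [pairing] at h
    have key : ∃ m, List.Forall₂ Iso l m ∧ m.Perm l' := by
      induction l generalizing l' with
      | nil =>
        cases l' with
        | nil => exact ⟨[], .nil, .nil⟩
        | cons a l' => simp [forestPairing] at h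
      | cons a l ihl =>
        rw [forestPairing] at h
        obtain ⟨x, hx, h⟩ := exists_mem_ne_zero_of_sum_ne_zero h
        have h1 := ih a (by simp) (left_ne_zero_of_mul h)
        obtain ⟨m, h2, h3⟩ := ihl (fun b hb => ih b (by simp [hb])) x.2 (right_ne_zero_of_mul h)
        exact ⟨x.1 :: m, .cons h1 h2, (h3.cons _).trans (perm_of_mem_picks hx)⟩
    have hc : Relation.Comp (List.Forall₂ Iso) List.Perm l l' := key
    rw [List.forall₂_comp_perm_eq_perm_comp_forall₂] at hc
    obtain ⟨m, h1, h2⟩ := hc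
    exact .node h1 h2

theorem pairing_eq_of_iso_left {s s' : PlanarTree} (h : Iso s s') (t : PlanarTree) :
    pairing s t = pairing s' t := by
  induction s using induction_on_branches generalizing s' t with
  | h l ih =>
    obtain ⟨hp, hf⟩ := h
    rename_i m l'
    rcases t with ⟨u⟩
    rw [pairing, pairing, forestPairing_perm_left hp]
    replace ih : ∀ a ∈ m, ∀ {s' : PlanarTree}, Iso a s' → ∀ t, pairing a t = pairing s' t :=
      fun a ha => ih a (hp.mem_iff.2 ha)
    clear hp
    induction hf generalizing u with
    | nil => rfl
    | cons h _ ihf =>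
      simp only [forestPairing, ih _ (by simp) h,
        ihf _ fun b hb => ih b (by simp [hb])]

theorem sum_picks_forall₂ {M : Type*} [AddCommMonoid M] {α : Type*} {r : α → α → Prop}
    {l l' : List α} (h : List.Forall₂ r l l') (f f' : α → List α → M)
    (hf : ∀ a a' m m', r a a' → List.Forall₂ r m m' → f a m = f' a' m') :
    ((picks l).map fun x => f x.1 x.2).sum = ((picks l').map fun x => f' x.1 x.2).sum := by
  induction h generalizing f f' with
  | nil => rfl
  | cons h hl ih =>
    rw [sum_picks_cons, sum_picks_cons, hf _ _ _ _ h hl,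
      ih _ _ fun a a' m m' ha hm => hf a a' _ _ ha (.cons h hm)]

theorem pairing_eq_of_iso_right (s : PlanarTree) {t t' : PlanarTree} (h : Iso t t') :
    pairing s t = pairing s t' := by
  induction s using induction_on_branches generalizing t t' with
  | h l ih =>
    obtain ⟨hp, hf⟩ := h
    rename_i m l'
    rw [pairing, pairing, forestPairing_perm_right l hp]
    clear hp
    induction l generalizing m l' with
    | nil => cases hf <;> simp [forestPairing]
    | cons a l ihl =>
      simp only [forestPairing]
      refine sum_picks_forall₂ hf (fun b r => pairing a b * forestPairing l r)
        (fun b r => pairing a b * forestPairing l r) fun b b' r r' hb hr => ?_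
      rw [ih a (by simp) hb, ihl (fun c hc => ih c (by simp [hc])) hr]

theorem sum_picks_ofFn {M : Type*} [AddCommMonoid M] {α : Type*} {n : ℕ} (b : Fin (n + 1) → α)
    (f : α → List α → M) :
    ((picks (List.ofFn b)).map fun x => f x.1 x.2).sum =
      ∑ j, f (b j) (List.ofFn fun i => b (j.succAbove i)) := by
  induction n generalizing f with
  | zero => simp [picks]
  | succ n ih =>
    rw [List.ofFn_succ, sum_picks_cons, ih (fun i => b i.succ) fun c r => f c (b 0 :: r),
      Fin.sum_univ_succ (n := n + 1)]
    simp only [Fin.succAbove_zero, List.ofFn_succ (n := n), Fin.succ_succAbove_zero,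
      Fin.succ_succAbove_succ]

theorem forestPairing_ofFn {n : ℕ} (a b : Fin n → PlanarTree) :
    forestPairing (List.ofFn a) (List.ofFn b) =
      ∑ σ : Equiv.Perm (Fin n), ∏ i, pairing (a i) (b (σ i)) := by
  induction n with
  | zero => simp [forestPairing]
  | succ n ih =>
    rw [List.ofFn_succ, forestPairing,
      sum_picks_ofFn b fun c r => pairing (a 0) c * forestPairing (List.ofFn fun i => a i.succ) r,
      ← Equiv.Perm.decomposeFin.symm.sum_comp, Fintype.sum_prod_type]
    refine Finset.sum_congr rfl fun j _ => ?_
    simp only [Fin.prod_univ_succ, Equiv.Perm.decomposeFin_symm_apply_zero,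
      Equiv.Perm.decomposeFin_symm_apply_succ, ← Finset.mul_sum]
    rw [← ih (fun i => a i.succ) fun i => b (Equiv.swap 0 j i.succ)]
    congr 1
    refine forestPairing_perm_right _ ?_
    refine (List.perm_cons (b j)).1 ?_
    have h1 : (b j :: List.ofFn fun i => b (j.succAbove i)).Perm (List.ofFn b) := by
      have h := Equiv.Perm.ofFn_comp_perm j.cycleRange.symm b
      rw [List.ofFn_succ] at h
      simpa [Function.comp_def] using h
    have h2 : b j :: List.ofFn (fun i => b (Equiv.swap 0 j i.succ)) =
        List.ofFn (b ∘ Equiv.swap 0 j) := by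
      simp [List.ofFn_succ]
    rw [h2]
    exact h1.trans (Equiv.Perm.ofFn_comp_perm _ _).symm

theorem pairing_self (t : PlanarTree) : pairing t t = t.sg := by
  induction t using induction_on_branches with
  | h l ih =>
    have h1 : ∀ i j : Fin l.length, pairing (l.get j) (l.get i) =
        if Iso (l.get j) (l.get i) then (l.get j).sg else 0 := by
      intro i j
      split_ifs with h
      · rw [← pairing_eq_of_iso_right _ h, ih _ (List.get_mem _ _)]
      · by_contra h0
        exact h (iso_of_pairing_ne_zero h0)
    have h2 : ∀ σ : Equiv.Perm (Fin l.length),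
        ∏ i, pairing (l.get i) (l.get (σ⁻¹ i)) =
          if ∀ i, Iso (l.get (σ i)) (l.get i) then (l.map sg).prod else 0 := by
      intro σ
      rw [← Equiv.prod_comp σ]
      simp only [← Equiv.Perm.mul_apply, inv_mul_cancel, Equiv.Perm.one_apply, h1]
      split_ifs with h
      · rw [Finset.prod_congr rfl fun i _ => if_pos (h i),
          Equiv.prod_comp σ fun i => (l.get i).sg]
        conv_rhs => rw [← List.ofFn_get l, List.map_ofFn, List.prod_ofFn]
        rfl
      · push Not at h
        obtain ⟨i, hi⟩ := h
        exact Finset.prod_eq_zero (Finset.mem_univ i) (if_neg hi)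
    have h3 := forestPairing_ofFn l.get l.get
    rw [List.ofFn_get] at h3
    rw [pairing, h3, ← Equiv.sum_comp (Equiv.inv _), sg, List.attach_map_val]
    simp only [Equiv.inv_apply, h2]
    rw [← Finset.sum_filter, Finset.sum_const, Nat.card_eq_fintype_card, Fintype.card_subtype,
      smul_eq_mul, mul_comm]

end PlanarTree
namespace RTree

open PlanarTree

theorem mk_rep (T : RTree) : mk T.rep = T := Quotient.out_eq T

theorem pairing_congr {p q : PlanarTree} (h : mk p = mk q) (t : PlanarTree) :
    pairing p t = pairing q t ∧ pairing t p = pairing t q := by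
  have h' : Relation.EqvGen PlanarTree.Iso p q := Quotient.exact h
  clear h
  induction h' with
  | rel _ _ h => exact ⟨pairing_eq_of_iso_left h t, pairing_eq_of_iso_right t h⟩
  | refl => exact ⟨rfl, rfl⟩
  | symm _ _ _ ih => exact ⟨ih.1.symm, ih.2.symm⟩
  | trans _ _ _ _ _ ih1 ih2 => exact ⟨ih1.1.trans ih2.1, ih1.2.trans ih2.2⟩

theorem mk_eq_mk_of_pairing_ne_zero {p q : PlanarTree} (h : pairing p q ≠ 0) : mk p = mk q :=
  Quotient.sound (Relation.EqvGen.rel _ _ (iso_of_pairing_ne_zero h))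

theorem size_mk (p : PlanarTree) : (mk p).size = p.size := by
  refine size_eq_of_pairing_ne_zero ?_
  rw [(pairing_congr (mk_rep (mk p)) p).1]
  exact pairing_self_ne_zero p

theorem sg_ne_zero (T : RTree) : T.sg ≠ 0 := by
  rw [sg, ← pairing_self]
  exact pairing_self_ne_zero _

theorem pairing_rep (p : PlanarTree) (T : RTree) :
    pairing p T.rep = if mk p = T then T.sg else 0 := by
  split_ifs with h
  · rw [sg, ← pairing_self, (pairing_congr (h.trans (mk_rep T).symm) _).1]
  · by_contra h0
    exact h ((mk_eq_mk_of_pairing_ne_zero h0).trans (mk_rep T))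

theorem rep_pairing (p : PlanarTree) (T : RTree) :
    pairing T.rep p = if mk p = T then T.sg else 0 := by
  split_ifs with h
  · rw [sg, ← pairing_self, (pairing_congr (h.trans (mk_rep T).symm) _).2]
  · by_contra h0
    exact h ((mk_eq_mk_of_pairing_ne_zero h0).symm.trans (mk_rep T))

end RTree

theorem RTree.size_bullet : RTree.bullet.size = 1 := by
  rw [RTree.bullet, RTree.size_mk, PlanarTree.size_node]
  simp

theorem RTree.sg_bullet : RTree.bullet.sg = 1 := by
  rw [RTree.sg, PlanarTree.eq_leaf_of_size_eq_one RTree.size_bullet, ← PlanarTree.pairing_self]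
  simp [PlanarTree.pairing, PlanarTree.forestPairing]

section Operators

variable (k : Type*)

section Semiring

variable [Semiring k]

theorem sum_single_mk_mul_sg (L : List PlanarTree) (T : RTree) :
    (L.map fun p => Finsupp.single (RTree.mk p) (1 : k)).sum T * (T.sg : k) =
      ((L.map fun p => PlanarTree.pairing p T.rep).sum : ℕ) := by
  induction L with
  | nil => simp
  | cons p L ih =>
    rw [List.map_cons, List.map_cons, List.sum_cons, List.sum_cons, Finsupp.add_apply, add_mul,
      ih, Nat.cast_add, RTree.pairing_rep, Finsupp.single_apply]
    split_ifs <;> simp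

theorem sum_single_mk_mul_sg' (L : List PlanarTree) (T : RTree) :
    (L.map fun p => Finsupp.single (RTree.mk p) (1 : k)).sum T * (T.sg : k) =
      ((L.map fun p => PlanarTree.pairing T.rep p).sum : ℕ) := by
  rw [sum_single_mk_mul_sg]
  simp only [RTree.pairing_rep, RTree.rep_pairing]

theorem Grow_single (T : RTree) : Grow k (Finsupp.single T 1) = growF k T := by
  simp [Grow]

theorem Prune_single (T : RTree) : Prune k (Finsupp.single T 1) = pruneF k T := by
  simp [Prune]

theorem Diag_single (T : RTree) :
    Diag k (Finsupp.single T 1) = (T.size : k) • Finsupp.single T 1 := by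
  simp [Diag]

theorem Prune_bullet : Prune k (Finsupp.single RTree.bullet 1) = 0 := by
  have h : RTree.bullet.rep = PlanarTree.node [] :=
    PlanarTree.eq_leaf_of_size_eq_one RTree.size_bullet
  simp [Prune_single, pruneF, h, PlanarTree.pruneList, PlanarTree.pruneAux]

end Semiring

section CommSemiring

variable [CommSemiring k]

theorem innerT_add_left (u u' v : RTree →₀ k) :
    innerT k (u + u') v = innerT k u v + innerT k u' v :=
  Finsupp.sum_add_index' (by simp) (by intros; ring)

theorem innerT_smul_left (c : k) (u v : RTree →₀ k) :
    innerT k (c • u) v = c * innerT k u v := by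
  rw [innerT, Finsupp.sum_smul_index (by simp), innerT, Finsupp.mul_sum]
  simp only [mul_assoc]

theorem innerT_add_right (u v v' : RTree →₀ k) :
    innerT k u (v + v') = innerT k u v + innerT k u v' := by
  simp [innerT, mul_add, add_mul, Finsupp.sum_add]

theorem innerT_smul_right (c : k) (u v : RTree →₀ k) :
    innerT k u (c • v) = c * innerT k u v := by
  rw [innerT, innerT, Finsupp.mul_sum]
  refine Finsupp.sum_congr fun T _ => ?_
  simp only [Finsupp.smul_apply, smul_eq_mul]
  ring

theorem innerT_single_left (T : RTree) (v : RTree →₀ k) :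
    innerT k (Finsupp.single T 1) v = v T * (T.sg : k) := by
  simp [innerT]

theorem innerT_single_right (u : RTree →₀ k) (T : RTree) :
    innerT k u (Finsupp.single T 1) = u T * (T.sg : k) := by
  rw [innerT, Finsupp.sum, Finset.sum_eq_single T]
  · simp
  · intro S _ hS
    simp [hS.symm]
  · intro h
    simp [Finsupp.notMem_support_iff.1 h]

/-- The operators `𝔑` and `𝔓` are adjoint. -/
theorem innerT_Grow (u v : RTree →₀ k) : innerT k (Grow k u) v = innerT k u (Prune k v) := by
  let B : (RTree →₀ k) →ₗ[k] (RTree →₀ k) →ₗ[k] k :=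
    LinearMap.mk₂ k (innerT k) (innerT_add_left k) (innerT_smul_left k)
      (innerT_add_right k) (innerT_smul_right k)
  suffices h : B.comp (Grow k) = B.compl₂ (Prune k) from
    LinearMap.congr_fun (LinearMap.congr_fun h u) v
  refine Finsupp.lhom_ext' fun S => LinearMap.ext_ring ?_
  refine Finsupp.lhom_ext' fun T => LinearMap.ext_ring ?_
  change innerT k (Grow k (Finsupp.single S 1)) (Finsupp.single T 1) =
    innerT k (Finsupp.single S 1) (Prune k (Finsupp.single T 1))
  rw [innerT_single_left, innerT_single_right, Grow_single, Prune_single, growF, pruneF,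
    sum_single_mk_mul_sg, sum_single_mk_mul_sg', PlanarTree.sum_growList_pairing]

theorem innerT_Grow_pow (c : ℕ) (u v : RTree →₀ k) :
    innerT k ((Grow k ^ c) u) v = innerT k u ((Prune k ^ c) v) := by
  induction c generalizing v with
  | zero => rfl
  | succ c ih =>
    rw [pow_succ', Module.End.mul_apply, innerT_Grow, ih, pow_succ, Module.End.mul_apply]

theorem Diag_Grow (v : RTree →₀ k) :
    Diag k (Grow k v) = Grow k (Diag k v) + Grow k v := by
  suffices h : Diag k ∘ₗ Grow k = Grow k ∘ₗ Diag k + Grow k from LinearMap.congr_fun h v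
  refine Finsupp.lhom_ext' fun T => LinearMap.ext_ring ?_
  simp only [LinearMap.comp_apply, LinearMap.add_apply, Finsupp.lsingle_apply]
  have h : ∀ u : RTree →₀ k, (T.size : k) • u + u = ((T.size : k) + 1) • u := fun u => by
    rw [add_smul, one_smul]
  rw [Diag_single, map_smul, Grow_single, h, growF, map_list_sum, List.map_map, List.smul_sum,
    List.map_map]
  refine congrArg List.sum (List.map_congr_left fun q hq => ?_)
  rw [Function.comp_apply, Function.comp_apply, Diag_single, RTree.size_mk,
    PlanarTree.size_of_mem_growList hq, Nat.cast_succ, RTree.size]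

end CommSemiring

variable [Field k] [CharZero k]

theorem finsupp_ext_mul_sg {u v : RTree →₀ k} (h : ∀ T, u T * (T.sg : k) = v T * (T.sg : k)) :
    u = v := by
  ext T
  exact mul_right_cancel₀ (Nat.cast_ne_zero.2 T.sg_ne_zero) (h T)

theorem Grow_single_mk (p : PlanarTree) :
    Grow k (Finsupp.single (RTree.mk p) 1) =
      (p.growList.map fun q => Finsupp.single (RTree.mk q) (1 : k)).sum := by
  rw [Grow_single, growF]
  refine finsupp_ext_mul_sg k fun T => ?_
  rw [sum_single_mk_mul_sg, sum_single_mk_mul_sg, PlanarTree.sum_growList_pairing,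
    PlanarTree.sum_growList_pairing]
  simp only [(RTree.pairing_congr (RTree.mk_rep (RTree.mk p)) _).1]

theorem Prune_single_mk (p : PlanarTree) :
    Prune k (Finsupp.single (RTree.mk p) 1) =
      (p.pruneList.map fun q => Finsupp.single (RTree.mk q) (1 : k)).sum := by
  rw [Prune_single, pruneF]
  refine finsupp_ext_mul_sg k fun T => ?_
  rw [sum_single_mk_mul_sg', sum_single_mk_mul_sg', ← PlanarTree.sum_growList_pairing,
    ← PlanarTree.sum_growList_pairing]
  simp only [(RTree.pairing_congr (RTree.mk_rep (RTree.mk p)) _).2]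

/-- The commutation relation `𝔓𝔑 - 𝔑𝔓 = 𝔇`. -/
theorem Prune_Grow (v : RTree →₀ k) :
    Prune k (Grow k v) = Grow k (Prune k v) + Diag k v := by
  suffices h : Prune k ∘ₗ Grow k = Grow k ∘ₗ Prune k + Diag k from LinearMap.congr_fun h v
  refine Finsupp.lhom_ext' fun T => LinearMap.ext_ring ?_
  have h := PlanarTree.sum_pruneList_growList T.rep
    fun q => Finsupp.single (RTree.mk q) (1 : k)
  simp only [LinearMap.comp_apply, LinearMap.add_apply, Finsupp.lsingle_apply]
  rw [Grow_single, Prune_single, Diag_single, growF, pruneF, map_list_sum, map_list_sum,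
    List.map_map, List.map_map]
  simp only [Function.comp_def, Prune_single_mk, Grow_single_mk, h, RTree.mk_rep, RTree.size,
    Nat.cast_smul_eq_nsmul]

theorem Diag_Grow_pow_bullet (c : ℕ) :
    Diag k ((Grow k ^ c) (Finsupp.single RTree.bullet 1)) =
      (c + 1 : k) • (Grow k ^ c) (Finsupp.single RTree.bullet 1) := by
  induction c with
  | zero =>
    simp [Diag_single, RTree.size_bullet]
  | succ c ih =>
    rw [pow_succ', Module.End.mul_apply, Diag_Grow, ih, map_smul, Nat.cast_succ,
      add_smul ((c : k) + 1), one_smul]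

theorem Prune_Grow_pow_bullet (c : ℕ) :
    Prune k ((Grow k ^ (c + 1)) (Finsupp.single RTree.bullet 1)) =
      ((c + 2).choose 2 : k) • (Grow k ^ c) (Finsupp.single RTree.bullet 1) := by
  induction c with
  | zero =>
    rw [zero_add, pow_one, Prune_Grow, Prune_bullet, map_zero, zero_add]
    simpa using Diag_Grow_pow_bullet k 0
  | succ c ih =>
    rw [pow_succ', Module.End.mul_apply, Prune_Grow, ih, map_smul, ← Module.End.mul_apply,
      ← pow_succ', Diag_Grow_pow_bullet, ← add_smul]
    congr 1
    rw [Nat.choose_succ_succ' (c + 2) 1, Nat.choose_one_right]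
    push_cast
    ring

theorem word_bullet (w : List Letter)
    (hvalid : ∀ i, ((w.drop i).count Letter.gP) ≤ ((w.drop i).count Letter.gN)) :
    (w.map (letterOp k)).prod (Finsupp.single RTree.bullet 1) =
      (∏ i ∈ (Finset.range w.length).filter (fun i => w.getD i Letter.gN = Letter.gP),
        (((((w.drop (i+1)).count Letter.gN - (w.drop i).count Letter.gP) + 2).choose 2 : ℕ) : k)) •
      (Grow k ^ (w.count Letter.gN - w.count Letter.gP)) (Finsupp.single RTree.bullet 1) := by
  induction w with
  | nil => simp
  | cons a w ih =>
    have hw := ih fun i => hvalid (i + 1)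
    have h0 := hvalid 0
    have h1 := hvalid 1
    simp only [List.drop_succ_cons, List.drop_zero] at h0 h1
    rw [List.map_cons, List.prod_cons, Module.End.mul_apply, hw, map_smul, Finset.prod_filter,
      Finset.prod_filter, List.length_cons, Finset.prod_range_succ']
    simp only [List.getD_cons_succ, List.drop_succ_cons, List.getD_cons_zero, List.drop_zero]
    rw [mul_smul]
    congr 1
    cases a with
    | gN =>
      rw [letterOp, ← Module.End.mul_apply, ← pow_succ', if_neg (by simp), one_smul]
      simp only [List.count_cons_self, ne_eq, reduceCtorEq, not_false_eq_true,
        List.count_cons_of_ne]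
      rw [Nat.sub_add_comm h1]
    | gP =>
      simp only [List.count_cons_self, ne_eq, reduceCtorEq, not_false_eq_true,
        List.count_cons_of_ne] at h0 ⊢
      obtain ⟨c, hc⟩ := Nat.exists_eq_add_of_le h0
      have e1 : w.count Letter.gN - w.count Letter.gP = c + 1 := by omega
      have e2 : w.count Letter.gN - (w.count Letter.gP + 1) = c := by omega
      rw [letterOp, e1, e2, Prune_Grow_pow_bullet, if_pos trivial]

end Operators

/-- For a valid `x`-word `w = w₁⋯w_r` (applied with `w_r` acting first),
`(w(•), x) = m(•;x) · Π_{i : w_i = 𝔓} C(c_i + 2, 2)`. -/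
theorem stmt9 (k : Type*) [Field k] [CharZero k] (n : ℕ) (x : RTree) (hx : x.size = n + 1)
    (w : List Letter)
    (hvalid : ∀ i, ((w.drop i).count Letter.gP) ≤ ((w.drop i).count Letter.gN))
    (hbal : w.count Letter.gN = w.count Letter.gP + n) :
    innerT k ((w.map (letterOp k)).prod (Finsupp.single RTree.bullet 1)) (Finsupp.single x 1)
      = mGen k RTree.bullet x *
        ∏ i ∈ (Finset.range w.length).filter (fun i => w.getD i Letter.gN = Letter.gP),
          (((((w.drop (i+1)).count Letter.gN - (w.drop i).count Letter.gP) + 2).choose 2 : ℕ) : k) := by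
  rw [word_bullet k w hvalid, innerT_smul_left, hbal, Nat.add_sub_cancel_left, innerT_Grow_pow,
    innerT_single_left, RTree.sg_bullet, mGen, hx, RTree.size_bullet, Nat.add_sub_cancel,
    Nat.cast_one, mul_one, mul_comm]
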